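/- Suppose β_n = (1 + (−1)^n)/2 (i.e. β_n = 1 for even n and β_n = 0 for odd n). Then for every real c: along even n, lim d_n(t_n + c·w_n) = 2·e^{−c}, and along odd n, lim d_n(t_n + r_n + c·w_n) = e^{−c}. Consequently a left-window cutoff holds at (t_n, w_n) and a right-window cutoff holds at (t_n + r_n, w_n), and these locations are distinct: the right-window location cannot be lowered and the left-window location cannot be raised by more than o(r_n). -/

import Mathlib

open Filter Real
open scoped ENNReal Topology

/-- `ℓ_n = log(n / log n)`. -/
noncomputable def ell (n : ℕ) : ℝ := Real.log (n / Real.log n)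

/-- Distance to equilibrium of the Ornstein–Uhlenbeck example of Barrera–Ycart:
`d_n(t) = Σ_{i=1}^{9^n} a_{i,n} e^{-ρ_{i,n} t}` with `a_{1,n} = e^n`,
`ρ_{1,n} = n/(1 + (β_n/n) ℓ_n)`, and for `2 ≤ i ≤ 9^n`:
`a_{i,n} = e^{-n}`, `ρ_{i,n} = log(e^n + (i-1) e^{-n})`. -/
noncomputable def dCut (β : ℕ → ℝ) (n : ℕ) (t : ℝ) : ℝ :=
  Real.exp n * Real.exp (-((n : ℝ) / (1 + β n / n * ell n)) * t) +
    ∑ i ∈ Finset.Icc (2 : ℕ) (9 ^ n),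
      Real.exp (-(n : ℝ)) *
        Real.exp (-Real.log (Real.exp n + ((i : ℝ) - 1) * Real.exp (-(n : ℝ))) * t)

/-- Cutoff location `t_n = 1 + β_n ℓ_n / n`. -/
noncomputable def cutT (β : ℕ → ℝ) (n : ℕ) : ℝ := 1 + β n * ell n / n

/-- Window width `w_n = t_n / n`. -/
noncomputable def cutW (β : ℕ → ℝ) (n : ℕ) : ℝ := cutT β n / n

/-- Correction term `r_n = ℓ_n w_n`. -/
noncomputable def cutR (β : ℕ → ℝ) (n : ℕ) : ℝ := ell n * cutW β n

/-- The part of `dCut` coming from the indices `i ≥ 2`. -/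
noncomputable def Spart (n : ℕ) (t : ℝ) : ℝ :=
  ∑ i ∈ Finset.Icc (2 : ℕ) (9 ^ n),
      Real.exp (-(n : ℝ)) *
        Real.exp (-Real.log (Real.exp n + ((i : ℝ) - 1) * Real.exp (-(n : ℝ))) * t)

lemma tele_upper (f g : ℕ → ℝ) (hfg : ∀ i, 1 ≤ i → f (i + 1) ≤ g i - g (i + 1)) (M : ℕ)
    (hM : 1 ≤ M) : ∑ i ∈ Finset.Icc 2 M, f i ≤ g 1 - g M := by
  induction M, hM using Nat.le_induction with
  | base => simp
  | succ k hk ih =>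
    rw [Finset.sum_Icc_succ_top (by omega)]
    linarith [hfg k hk]

lemma tele_lower (f g : ℕ → ℝ) (hfg : ∀ i, 2 ≤ i → g i - g (i + 1) ≤ f i) (M : ℕ)
    (hM : 1 ≤ M) : g 2 - g (M + 1) ≤ ∑ i ∈ Finset.Icc 2 M, f i := by
  induction M, hM using Nat.le_induction with
  | base => simp
  | succ k hk ih =>
    rw [Finset.sum_Icc_succ_top (by omega)]
    linarith [hfg (k + 1) (by omega)]

/-- one-step integral comparison, upper -/
lemma step_upper (u h s : ℝ) (hu : 0 < u) (hh : 0 < h) (hs : 0 < s) :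
    h * exp (-log (u + h) * (1 + s)) ≤ exp (-s * log u) / s - exp (-s * log (u + h)) / s := by
  have huh : 0 < u + h := by positivity
  have h1 : h / (u + h) ≤ log (u + h) - log u := by
    have := Real.log_le_sub_one_of_pos (x := u / (u + h)) (by positivity)
    rw [Real.log_div hu.ne' huh.ne'] at this
    have e : u / (u + h) - 1 = - (h / (u + h)) := by field_simp; ring
    linarith
  have h2 : exp (-s * log u) = exp (-s * log (u + h)) * exp (s * (log (u + h) - log u)) := by
    rw [← exp_add]; ring_nf
  have h3 := add_one_le_exp (s * (log (u + h) - log u))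
  have h4 : exp (-log (u + h) * (1 + s)) = exp (-s * log (u + h)) / (u + h) := by
    rw [show -log (u + h) * (1 + s) = -s * log (u + h) - log (u + h) by ring, exp_sub,
      exp_log huh]
  rw [h4, h2, ← sub_div, le_div_iff₀ hs]
  have hE := exp_pos (-s * log (u + h))
  have h5 : s * (h / (u + h)) ≤ exp (s * (log (u + h) - log u)) - 1 := by nlinarith
  calc _ = exp (-s * log (u + h)) * (s * (h / (u + h))) := by ring
    _ ≤ exp (-s * log (u + h)) * (exp (s * (log (u + h) - log u)) - 1) := by gcongr
    _ = _ := by ring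

lemma step_lower (u h s : ℝ) (hu : 0 < u) (hh : 0 < h) (hs : 0 < s) :
    exp (-s * log u) / s - exp (-s * log (u + h)) / s ≤ h * exp (-log u * (1 + s)) := by
  have huh : 0 < u + h := by positivity
  have h1 : log (u + h) - log u ≤ h / u := by
    have := Real.log_le_sub_one_of_pos (x := (u + h) / u) (by positivity)
    rw [Real.log_div huh.ne' hu.ne'] at this
    have e : (u + h) / u - 1 = h / u := by field_simp; ring
    linarith
  have h2 : exp (-s * log (u + h)) = exp (-s * log u) * exp (-(s * (log (u + h) - log u))) := by
    rw [← exp_add]; ring_nf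
  have h3 := add_one_le_exp (-(s * (log (u + h) - log u)))
  have h4 : exp (-log u * (1 + s)) = exp (-s * log u) / u := by
    rw [show -log u * (1 + s) = -s * log u - log u by ring, exp_sub, exp_log hu]
  rw [h4, h2, ← sub_div, div_le_iff₀ hs]
  have hE := exp_pos (-s * log u)
  have h5 : 1 - exp (-(s * (log (u + h) - log u))) ≤ s * (h / u) := by nlinarith
  calc _ = exp (-s * log u) * (1 - exp (-(s * (log (u + h) - log u)))) := by ring
    _ ≤ exp (-s * log u) * (s * (h / u)) := by gcongr
    _ = _ := by ring

lemma Spart_upper (n : ℕ) (hn : 1 ≤ n) (z : ℝ) (hz : 0 < z) :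
    Spart n (1 + z / n) ≤ n / z * exp (-z) := by
  have hn0 : (0 : ℝ) < n := by exact_mod_cast hn
  have hs : 0 < z / n := by positivity
  have key := tele_upper
    (fun i => exp (-(n : ℝ)) * exp (-log (exp n + ((i : ℝ) - 1) * exp (-(n : ℝ))) * (1 + z / n)))
    (fun i => exp (-(z / n) * log (exp n + ((i : ℝ) - 1) * exp (-(n : ℝ)))) / (z / n))
    (by
      intro i hi
      have hi' : (1 : ℝ) ≤ i := by exact_mod_cast hi
      have hu : 0 < exp (n : ℝ) + ((i : ℝ) - 1) * exp (-(n : ℝ)) := by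
        have := exp_pos (n : ℝ); have := exp_pos (-(n : ℝ)); nlinarith
      have := step_upper _ (exp (-(n : ℝ))) (z / n) hu (exp_pos _) hs
      have e : exp (n : ℝ) + (((i + 1 : ℕ) : ℝ) - 1) * exp (-(n : ℝ)) =
        exp (n : ℝ) + ((i : ℝ) - 1) * exp (-(n : ℝ)) + exp (-(n : ℝ)) := by push_cast; ring
      simp only [e]
      exact this) (9 ^ n) (Nat.one_le_pow _ _ (by norm_num))
  unfold Spart
  refine key.trans ?_
  have hpos : 0 ≤ exp (-(z / n) * log (exp n + (((9 ^ n : ℕ) : ℝ) - 1) * exp (-(n : ℝ)))) / (z / n) := by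
    positivity
  refine (sub_le_self _ hpos).trans (le_of_eq ?_)
  simp only [Nat.cast_one, sub_self, zero_mul, add_zero, log_exp]
  rw [show -(z / n) * (n : ℝ) = -z by field_simp]
  field_simp

lemma Spart_lower (n : ℕ) (hn : 1 ≤ n) (z : ℝ) (hz : 0 < z) :
    n / z * (exp (-z - z / n) - exp (-z * (log 9 - 1))) ≤ Spart n (1 + z / n) := by
  have hn0 : (0 : ℝ) < n := by exact_mod_cast hn
  have hs : 0 < z / n := by positivity
  have key := tele_lower
    (fun i => exp (-(n : ℝ)) * exp (-log (exp n + ((i : ℝ) - 1) * exp (-(n : ℝ))) * (1 + z / n)))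
    (fun i => exp (-(z / n) * log (exp n + ((i : ℝ) - 1) * exp (-(n : ℝ)))) / (z / n))
    (by
      intro i hi
      have hi' : (2 : ℝ) ≤ i := by exact_mod_cast hi
      have hu : 0 < exp (n : ℝ) + ((i : ℝ) - 1) * exp (-(n : ℝ)) := by
        have := exp_pos (n : ℝ); have := exp_pos (-(n : ℝ)); nlinarith
      have := step_lower _ (exp (-(n : ℝ))) (z / n) hu (exp_pos _) hs
      have e : exp (n : ℝ) + (((i + 1 : ℕ) : ℝ) - 1) * exp (-(n : ℝ)) =
        exp (n : ℝ) + ((i : ℝ) - 1) * exp (-(n : ℝ)) + exp (-(n : ℝ)) := by push_cast; ring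
      simp only [e]
      exact this) (9 ^ n) (Nat.one_le_pow _ _ (by norm_num))
  unfold Spart
  refine le_trans ?_ key
  rw [← sub_div, div_div_eq_mul_div, mul_comm, mul_div_assoc]
  refine mul_le_mul_of_nonneg_right (sub_le_sub (exp_le_exp.2 ?_) (exp_le_exp.2 ?_))
    (by positivity)
  · push_cast
    have h1 : log (exp n + ((2:ℝ) - 1) * exp (-(n : ℝ))) ≤ n + 1 := by
      rw [log_le_iff_le_exp (by positivity), exp_add]
      have a1 : exp (-(n:ℝ)) ≤ exp n := exp_le_exp.2 (by linarith)
      have a2 := add_one_le_exp (1 : ℝ)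
      have a3 := exp_pos (n : ℝ)
      nlinarith
    have : z / n * log (exp n + ((2:ℝ) - 1) * exp (-(n : ℝ))) ≤ z / n * (n + 1) := by gcongr
    have e : z / n * ((n : ℝ) + 1) = z + z / n := by field_simp
    linarith
  · have h1 : n * (log 9 - 1) ≤ log (exp n + (((9 ^ n + 1 : ℕ) : ℝ) - 1) * exp (-(n : ℝ))) := by
      push_cast
      rw [add_sub_cancel_right, le_log_iff_exp_le (by positivity),
        show n * (log 9 - 1) = n * log 9 + -(n : ℝ) by ring, exp_add, exp_nat_mul,
        exp_log (by norm_num)]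
      linarith [exp_pos (n : ℝ)]
    have : z / n * (n * (log 9 - 1)) ≤ 
      z / n * log (exp n + (((9 ^ n + 1 : ℕ) : ℝ) - 1) * exp (-(n : ℝ))) := by gcongr
    have e : z / n * (n * (log 9 - 1)) = z * (log 9 - 1) := by field_simp
    linarith

lemma Spart_anti (n : ℕ) {t t' : ℝ} (h : t ≤ t') : Spart n t' ≤ Spart n t := by
  unfold Spart
  refine Finset.sum_le_sum fun i hi => ?_
  have hi' : (2 : ℝ) ≤ i := by exact_mod_cast (Finset.mem_Icc.1 hi).1
  have hl : 0 ≤ log (exp n + ((i : ℝ) - 1) * exp (-(n : ℝ))) := by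
    apply log_nonneg
    have a1 : (1 : ℝ) ≤ exp n := one_le_exp (by positivity)
    have a2 := exp_pos (-(n : ℝ))
    nlinarith
  refine mul_le_mul_of_nonneg_left (exp_le_exp.2 ?_) (exp_pos _).le
  nlinarith

lemma Spart_nonneg (n : ℕ) (t : ℝ) : 0 ≤ Spart n t := by
  unfold Spart; positivity

lemma tendsto_logn : Tendsto (fun n : ℕ => log (n : ℝ)) atTop atTop :=
  tendsto_log_atTop.comp tendsto_natCast_atTop_atTop

lemma ell_eq : ∀ᶠ n : ℕ in atTop, ell n = log n - log (log n) := by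
  filter_upwards [tendsto_logn.eventually_gt_atTop 0, eventually_gt_atTop 0] with n h1 h2
  unfold ell
  rw [log_div (by positivity) h1.ne']

lemma ell_div_log : Tendsto (fun n : ℕ => ell n / log n) atTop (𝓝 1) := by
  have h : Tendsto (fun n : ℕ => log (log (n : ℝ)) / log n) atTop (𝓝 0) :=
    (Real.isLittleO_log_id_atTop.tendsto_div_nhds_zero).comp tendsto_logn
  have h2 := (tendsto_const_nhds (x := (1 : ℝ))).sub h
  rw [sub_zero] at h2
  refine h2.congr' ?_
  filter_upwards [ell_eq, tendsto_logn.eventually_gt_atTop 0] with n h1 h3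
  rw [h1, sub_div, div_self h3.ne']

lemma ell_atTop : Tendsto ell atTop atTop := by
  have := ell_div_log.pos_mul_atTop one_pos tendsto_logn
  refine this.congr' ?_
  filter_upwards [tendsto_logn.eventually_gt_atTop 0] with n h3
  field_simp

lemma ell_div_n : Tendsto (fun n : ℕ => ell n / n) atTop (𝓝 0) := by
  have h : Tendsto (fun n : ℕ => log (n : ℝ) / n) atTop (𝓝 0) :=
    (Real.isLittleO_log_id_atTop.tendsto_div_nhds_zero).comp tendsto_natCast_atTop_atTop
  have h2 := ell_div_log.mul h
  rw [mul_zero] at h2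
  refine h2.congr' ?_
  filter_upwards [tendsto_logn.eventually_gt_atTop 0] with n h3
  field_simp

lemma log9 : (2 : ℝ) < log 9 := by
  rw [lt_log_iff_exp_lt (by norm_num), show (2 : ℝ) = 1 + 1 by norm_num, exp_add]
  have := exp_one_lt_d9
  have := exp_pos (1 : ℝ)
  nlinarith

lemma exp_neg_ell : ∀ᶠ n : ℕ in atTop, (n : ℝ) * exp (-ell n) = log n := by
  filter_upwards [tendsto_logn.eventually_gt_atTop 0, eventually_gt_atTop 0] with n h1 h2
  have : (0 : ℝ) < n := by exact_mod_cast h2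
  unfold ell
  rw [exp_neg, exp_log (by positivity)]
  field_simp

lemma Spart_tendsto (y : ℕ → ℝ) (c : ℝ) (hy : Tendsto y atTop (𝓝 c)) :
    Tendsto (fun n : ℕ => Spart n (1 + (ell n + y n) / n)) atTop (𝓝 (exp (-c))) := by
  have hz : Tendsto (fun n => ell n + y n) atTop atTop := ell_atTop.atTop_add hy
  have hzn : Tendsto (fun n : ℕ => (ell n + y n) / n) atTop (𝓝 0) := by
    have := ell_div_n.add (hy.div_atTop tendsto_natCast_atTop_atTop)
    simpa [add_div] using this
  have hzl : Tendsto (fun n : ℕ => log (n : ℝ) / (ell n + y n)) atTop (𝓝 1) := by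
    have := (ell_div_log.add (hy.div_atTop tendsto_logn)).inv₀ (by norm_num)
    simpa [← add_div] using this
  have hU : Tendsto (fun n : ℕ => log (n : ℝ) / (ell n + y n) * exp (-y n)) atTop
      (𝓝 (exp (-c))) := by
    simpa using hzl.mul ((continuous_exp.tendsto _).comp hy.neg)
  have h1 : Tendsto (fun n : ℕ => exp (-((ell n + y n) / n))) atTop (𝓝 1) := by
    simpa [Function.comp_def] using (continuous_exp.tendsto _).comp hzn.neg
  have h2 : Tendsto (fun n : ℕ => exp (-((ell n + y n) * (log 9 - 2)))) atTop (𝓝 0) :=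
    tendsto_exp_neg_atTop_nhds_zero.comp (hz.atTop_mul_const (by linarith [log9]))
  have hL := hU.mul (h1.sub h2)
  rw [sub_zero, mul_one] at hL
  refine tendsto_of_tendsto_of_tendsto_of_le_of_le' hL hU ?_ ?_
  · filter_upwards [hz.eventually_gt_atTop 0, eventually_ge_atTop 1, exp_neg_ell] with n h3 h4 h5
    refine le_trans (le_of_eq ?_) (Spart_lower n h4 _ h3)
    rw [← h5, show -(ell n + y n) - (ell n + y n) / n =
      -ell n + -y n + -((ell n + y n) / n) by ring,
      show -(ell n + y n) * (log 9 - 1) = -ell n + -y n + -((ell n + y n) * (log 9 - 2)) by ring]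
    simp only [exp_add]
    ring
  · filter_upwards [hz.eventually_gt_atTop 0, eventually_ge_atTop 1, exp_neg_ell] with n h3 h4 h5
    refine (Spart_upper n h4 _ h3).trans (le_of_eq ?_)
    rw [← h5, neg_add, exp_add]
    ring

lemma dCut_eq (β : ℕ → ℝ) (n : ℕ) (hn : 1 ≤ n) (hT : 0 < cutT β n) (x t : ℝ)
    (ht : t = cutT β n + x * cutW β n) :
    dCut β n t = exp (-x) + Spart n t := by
  have hn0 : (0 : ℝ) < n := by exact_mod_cast hn
  unfold dCut Spart
  congr 1
  rw [← exp_add]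
  congr 1
  have e : 1 + β n / n * ell n = cutT β n := by unfold cutT; ring
  rw [e, ht]
  unfold cutW
  field_simp
  ring

lemma even_atTop : Tendsto (fun k : ℕ => 2 * k) atTop atTop :=
  tendsto_atTop_mono (fun k => by simp only [id]; omega) tendsto_id
lemma odd_atTop : Tendsto (fun k : ℕ => 2 * k + 1) atTop atTop :=
  tendsto_atTop_mono (fun k => by simp only [id]; omega) tendsto_id

lemma cutT_ge (β : ℕ → ℝ) (hβ : ∀ n, β n = (1 + (-1 : ℝ) ^ n) / 2) (n : ℕ)
    (h : 0 ≤ ell n) : 1 ≤ cutT β n := by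
  have : 0 ≤ β n := by
    rw [hβ]; rcases neg_one_pow_eq_or ℝ n with h | h <;> rw [h] <;> norm_num
  unfold cutT
  have : 0 ≤ β n * ell n / n := by positivity
  linarith

lemma cutT_even (β : ℕ → ℝ) (hβ : ∀ n, β n = (1 + (-1 : ℝ) ^ n) / 2) (k : ℕ) :
    cutT β (2 * k) = 1 + ell (2 * k) / (2 * k : ℕ) := by
  unfold cutT
  rw [hβ]; simp

lemma cutT_odd (β : ℕ → ℝ) (hβ : ∀ n, β n = (1 + (-1 : ℝ) ^ n) / 2) (k : ℕ) :
    cutT β (2 * k + 1) = 1 := by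
  unfold cutT
  rw [hβ]; simp [pow_succ]

/-- Case `β_n = (1 + (-1)^n)/2` of Barrera–Ycart: along even `n`,
`d_n(t_n + c w_n) → 2 e^{-c}`; along odd `n`, `d_n(t_n + r_n + c w_n) → e^{-c}`.
Consequently a left-window cutoff holds at `(t_n, w_n)` and a right-window cutoff
holds at `(t_n + r_n, w_n)`, and these locations are distinct: the right-window
location cannot be lowered, nor the left-window location raised, by `ε r_n`. -/
theorem alternating_beta
    (β : ℕ → ℝ) (hβ : ∀ n, β n = (1 + (-1 : ℝ) ^ n) / 2) :
    (∀ c : ℝ, Tendsto (fun k : ℕ => dCut β (2 * k) (cutT β (2 * k) + c * cutW β (2 * k)))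
        atTop (𝓝 (2 * Real.exp (-c)))) ∧
    (∀ c : ℝ, Tendsto
        (fun k : ℕ => dCut β (2 * k + 1)
          (cutT β (2 * k + 1) + cutR β (2 * k + 1) + c * cutW β (2 * k + 1)))
        atTop (𝓝 (Real.exp (-c)))) ∧
    -- left-window cutoff at `(t_n, w_n)`
    Tendsto
      (fun c : ℝ => Filter.liminf
        (fun n => ENNReal.ofReal (dCut β n (cutT β n + c * cutW β n))) atTop)
      atBot (𝓝 (⊤ : ℝ≥0∞)) ∧
    -- right-window cutoff at `(t_n + r_n, w_n)`
    Tendsto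
      (fun c : ℝ => Filter.limsup
        (fun n => ENNReal.ofReal (dCut β n (cutT β n + cutR β n + c * cutW β n))) atTop)
      atTop (𝓝 (0 : ℝ≥0∞)) ∧
    -- the right-window location cannot be lowered by `ε r_n`
    (∀ ε : ℝ, 0 < ε → ε ≤ 1 →
      ¬ Tendsto
        (fun c : ℝ => Filter.limsup
          (fun n => ENNReal.ofReal
            (dCut β n (cutT β n + (1 - ε) * cutR β n + c * cutW β n))) atTop)
        atTop (𝓝 (0 : ℝ≥0∞))) ∧
    -- the left-window location cannot be raised by `ε r_n`
    (∀ ε : ℝ, 0 < ε → ε ≤ 1 →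
      ¬ Tendsto
        (fun c : ℝ => Filter.liminf
          (fun n => ENNReal.ofReal
            (dCut β n (cutT β n + ε * cutR β n + c * cutW β n))) atTop)
        atBot (𝓝 (⊤ : ℝ≥0∞))) := by
  have ellpos : ∀ᶠ n : ℕ in atTop, 0 ≤ ell n := ell_atTop.eventually_ge_atTop 0
  refine ⟨?_, ?_, ?_, ?_, ?_, ?_⟩
  · intro c
    have hS := Spart_tendsto (fun n => c + c * (ell n / n)) c
      (by simpa using (ell_div_n.const_mul c).const_add c)
    have := (hS.comp even_atTop).const_add (exp (-c))
    rw [← two_mul] at this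
    refine this.congr' ?_
    filter_upwards [even_atTop.eventually ellpos, even_atTop.eventually (eventually_ge_atTop 1)]
      with k h1 h2
    have hT := cutT_ge β hβ _ h1
    rw [dCut_eq β (2 * k) h2 (by linarith) c _ rfl]
    simp only [Function.comp]
    congr 2
    unfold cutW
    rw [cutT_even β hβ]
    ring
  · intro c
    have hS := Spart_tendsto (fun n => c) c tendsto_const_nhds
    have h0 : Tendsto (fun n => exp (-(ell n + c))) atTop (𝓝 0) :=
      tendsto_exp_neg_atTop_nhds_zero.comp (ell_atTop.atTop_add tendsto_const_nhds)
    have := (h0.add hS).comp odd_atTop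
    rw [zero_add] at this
    refine this.congr' ?_
    filter_upwards [odd_atTop.eventually ellpos, odd_atTop.eventually (eventually_ge_atTop 1)]
      with k h1 h2
    have hT := cutT_ge β hβ _ h1
    rw [dCut_eq β (2 * k + 1) h2 (by linarith) (ell (2 * k + 1) + c) _ (by unfold cutR; ring)]
    simp only [Function.comp]
    congr 2
    unfold cutR cutW
    rw [cutT_odd β hβ]
    ring
  · have h1 : Tendsto (fun c : ℝ => ENNReal.ofReal (exp (-c))) atBot (𝓝 ⊤) :=
      ENNReal.tendsto_ofReal_atTop.comp (tendsto_exp_atTop.comp tendsto_neg_atBot_atTop)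
    refine tendsto_of_tendsto_of_tendsto_of_le_of_le h1 tendsto_const_nhds ?_ (fun _ => le_top)
    intro c
    refine le_liminf_of_le (by isBoundedDefault) ?_
    filter_upwards [ellpos, eventually_ge_atTop 1] with n h1 h2
    have hT := cutT_ge β hβ _ h1
    rw [dCut_eq β n h2 (by linarith) c _ rfl]
    exact ENNReal.ofReal_le_ofReal (by linarith [Spart_nonneg n (cutT β n + c * cutW β n)])
  · have h1 : Tendsto (fun c : ℝ => ENNReal.ofReal (exp (-c))) atTop (𝓝 0) := by
      have := ENNReal.tendsto_ofReal tendsto_exp_neg_atTop_nhds_zero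
      simpa using this
    refine tendsto_of_tendsto_of_tendsto_of_le_of_le' tendsto_const_nhds h1
      (Eventually.of_forall fun _ => zero_le) ?_
    filter_upwards [eventually_ge_atTop 0] with c hc
    have hS := Spart_tendsto (fun n => c) c tendsto_const_nhds
    have h0 : Tendsto (fun n => exp (-(ell n + c))) atTop (𝓝 0) :=
      tendsto_exp_neg_atTop_nhds_zero.comp (ell_atTop.atTop_add tendsto_const_nhds)
    have := ENNReal.tendsto_ofReal (h0.add hS)
    rw [zero_add] at this
    rw [← this.limsup_eq]
    refine limsup_le_limsup ?_ (by isBoundedDefault) (by isBoundedDefault)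
    filter_upwards [ellpos, eventually_ge_atTop 1] with n h1 h2
    have hT := cutT_ge β hβ _ h1
    rw [dCut_eq β n h2 (by linarith) (ell n + c) _ (by unfold cutR; ring)]
    refine ENNReal.ofReal_le_ofReal (add_le_add le_rfl (Spart_anti n ?_))
    have : (ell n + c) * (1 / n) ≤ (ell n + c) * cutW β n := by
      unfold cutW; gcongr
    unfold cutR
    have e : (ell n + c) / n = (ell n + c) * (1 / n) := by ring
    rw [e]
    linarith
  · intro ε hε hε1 hcon
    have hS := (Spart_tendsto (fun n => 0) 0 tendsto_const_nhds).comp odd_atTop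
    rw [neg_zero, exp_zero] at hS
    have hev := hcon.eventually (gt_mem_nhds (show (0 : ℝ≥0∞) < ENNReal.ofReal (1 / 2) by simp))
    obtain ⟨c, hc⟩ := hev.exists
    refine absurd hc (not_lt.2 ?_)
    refine le_limsup_of_frequently_le ?_ (by isBoundedDefault)
    refine odd_atTop.frequently (Eventually.frequently ?_)
    have hE : ∀ᶠ n : ℕ in atTop, c ≤ ε * ell n :=
      (ell_atTop.const_mul_atTop hε).eventually_ge_atTop c
    filter_upwards [odd_atTop.eventually ellpos, odd_atTop.eventually (eventually_ge_atTop 1),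
      odd_atTop.eventually hE, hS.eventually (lt_mem_nhds (show (1 / 2 : ℝ) < 1 by norm_num))]
      with k h1 h2 h3 h4
    have hT := cutT_ge β hβ _ h1
    rw [dCut_eq β (2 * k + 1) h2 (by linarith) ((1 - ε) * ell (2 * k + 1) + c) _
      (by unfold cutR; ring)]
    refine ENNReal.ofReal_le_ofReal (h4.le.trans ?_)
    refine le_trans (Spart_anti _ ?_) (le_add_of_nonneg_left (exp_pos _).le)
    unfold cutR cutW
    rw [cutT_odd β hβ]
    have : ((1 - ε) * ell (2 * k + 1) + c) / (2 * k + 1 : ℕ) ≤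
      (ell (2 * k + 1) + 0) / (2 * k + 1 : ℕ) := by
      refine div_le_div_of_nonneg_right ?_ (Nat.cast_nonneg _)
      linarith
    refine le_trans (le_of_eq ?_) (add_le_add (le_refl (1 : ℝ)) this)
    ring
  · intro ε hε hε1 hcon
    have hS := (Spart_tendsto (fun n => 0) 0 tendsto_const_nhds).comp even_atTop
    rw [neg_zero, exp_zero] at hS
    have hev := hcon.eventually (lt_mem_nhds (show ENNReal.ofReal 3 < ⊤ by simp))
    obtain ⟨c, hc⟩ := hev.exists
    refine absurd hc (not_lt.2 ?_)
    refine liminf_le_of_frequently_le ?_ (by isBoundedDefault)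
    refine even_atTop.frequently (Eventually.frequently ?_)
    have hE : ∀ᶠ n : ℕ in atTop, -c ≤ ε * ell n :=
      (ell_atTop.const_mul_atTop hε).eventually_ge_atTop (-c)
    filter_upwards [even_atTop.eventually ellpos, even_atTop.eventually (eventually_ge_atTop 1),
      even_atTop.eventually hE, hS.eventually (gt_mem_nhds (show (1 : ℝ) < 2 by norm_num))]
      with k h1 h2 h3 h4
    have hT := cutT_ge β hβ _ h1
    rw [dCut_eq β (2 * k) h2 (by linarith) (ε * ell (2 * k) + c) _
      (by unfold cutR; ring)]
    refine ENNReal.ofReal_le_ofReal ?_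
    have a1 : exp (-(ε * ell (2 * k) + c)) ≤ 1 := exp_le_one_iff.2 (by linarith)
    have a2 : Spart (2 * k) (cutT β (2 * k) + ε * cutR β (2 * k) + c * cutW β (2 * k)) ≤
        Spart (2 * k) (1 + (ell (2 * k) + 0) / (2 * k : ℕ)) := by
      refine Spart_anti _ ?_
      rw [add_zero, ← cutT_even β hβ]
      have hW : 0 ≤ cutW β (2 * k) := by unfold cutW; positivity
      have : 0 ≤ (ε * ell (2 * k) + c) * cutW β (2 * k) := mul_nonneg (by linarith) hW
      unfold cutR
      linarith
    simp only [Function.comp] at h4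
    linarith
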